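/- arXiv:2506.02723 — 3 statements merged into one kernel-verified Lean document; each statement's English description precedes it below -/
import Mathlib

section
/- Let κ ∈ ℝ, L > 0, N > 1, and let φ : [0,1] → (0,∞) be continuous and satisfy the distributional differential inequality (φ^{1/(N−1)})'' − κ·L²·φ^{1/(N−1)} ≤ 0 on (0,1). Then for all t₀, t₁ ∈ [0,1] and s ∈ [0,1], writing σ for the generalized distortion coefficients with parameter −κ, one has φ((1−s)t₀ + s t₁)^{1/(N−1)} ≥ σ_{−κ}^{(1−s)}(|t₁−t₀|·L)·φ(t₀)^{1/(N−1)} + σ_{−κ}^{(s)}(|t₁−t₀|·L)·φ(t₁)^{1/(N−1)}. -/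
open MeasureTheory Real

/-- Generalized distortion coefficient `σ_κ^{(t)}(θ)` (with the convention
`σ_κ^{(t)}(0) = t`). -/
noncomputable def sigmaCoeff (κ t θ : ℝ) : ℝ :=
  if θ = 0 then t
  else if 0 < κ then Real.sin (Real.sqrt κ * (t * θ)) / Real.sin (Real.sqrt κ * θ)
  else if κ < 0 then Real.sinh (Real.sqrt (-κ) * (t * θ)) / Real.sinh (Real.sqrt (-κ) * θ)
  else t

theorem sturm_comparison {v v' v'' S C : ℝ → ℝ} {k a b x : ℝ} (hx : x ∈ Set.Icc a b)
    (hv : ∀ y ∈ Set.Icc a b, HasDerivAt v (v' y) y)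
    (hv' : ∀ y ∈ Set.Icc a b, HasDerivAt v' (v'' y) y)
    (hle : ∀ y ∈ Set.Icc a b, v'' y ≤ k * v y)
    (hS : ∀ y, HasDerivAt S (C y) y) (hC : ∀ y, HasDerivAt C (k * S y) y)
    (hS0 : S 0 = 0) (hC0 : 0 < C 0)
    (hadd : ∀ y z, S y * C z + C y * S z = C 0 * S (y + z))
    (hpos : ∀ y ∈ Set.Icc 0 (b - a), 0 ≤ S y) :
    v a * S (b - x) + v b * S (x - a) ≤ v x * S (b - a) := by
  have hab : a ≤ b := hx.1.trans hx.2
  have hl : ∀ y ∈ Set.Icc a b, HasDerivAt (fun y ↦ v' y * S (y - a) - v y * C (y - a))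
      ((v'' y - k * v y) * S (y - a)) y := fun y hy ↦ by
    have h1 := (hS (y - a)).comp_sub_const y a
    have h2 := (hC (y - a)).comp_sub_const y a
    exact (((hv' y hy).mul h1).sub ((hv y hy).mul h2)).congr_deriv (by ring)
  have hr : ∀ y ∈ Set.Icc a b, HasDerivAt (fun y ↦ v' y * S (b - y) + v y * C (b - y))
      ((v'' y - k * v y) * S (b - y)) y := fun y hy ↦ by
    have h1 := (hS (b - y)).comp_const_sub b y
    have h2 := (hC (b - y)).comp_const_sub b y
    exact (((hv' y hy).mul h1).add ((hv y hy).mul h2)).congr_deriv (by ring)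
  have hl' := antitoneOn_of_deriv_nonpos (convex_Icc a b)
    (fun y hy ↦ (hl y hy).continuousAt.continuousWithinAt)
    (fun y hy ↦ (hl y (interior_subset hy)).differentiableAt.differentiableWithinAt)
    (fun y hy ↦ by
      have hy := interior_subset hy
      rw [(hl y hy).deriv]
      exact mul_nonpos_of_nonpos_of_nonneg (sub_nonpos.2 (hle y hy))
        (hpos _ ⟨by linarith [hy.1], by linarith [hy.2]⟩))
    (Set.left_mem_Icc.2 hab) hx hx.1
  have hr' := antitoneOn_of_deriv_nonpos (convex_Icc a b)
    (fun y hy ↦ (hr y hy).continuousAt.continuousWithinAt)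
    (fun y hy ↦ (hr y (interior_subset hy)).differentiableAt.differentiableWithinAt)
    (fun y hy ↦ by
      have hy := interior_subset hy
      rw [(hr y hy).deriv]
      exact mul_nonpos_of_nonpos_of_nonneg (sub_nonpos.2 (hle y hy))
        (hpos _ ⟨by linarith [hy.2], by linarith [hy.1]⟩))
    hx (Set.right_mem_Icc.2 hab) hx.2
  simp only [sub_self, hS0, mul_zero, zero_sub, zero_add] at hl' hr'
  have h1 := mul_le_mul_of_nonneg_right hl'
    (hpos (b - x) ⟨by linarith [hx.2], by linarith [hx.1]⟩)
  have h2 := mul_le_mul_of_nonneg_right hr'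
    (hpos (x - a) ⟨by linarith [hx.1], by linarith [hx.2]⟩)
  have h3 := hadd (x - a) (b - x)
  rw [show x - a + (b - x) = b - a by ring] at h3
  refine le_of_mul_le_mul_left ?_ hC0
  have : C 0 * (v x * S (b - a)) = v x * (S (x - a) * C (b - x) + C (x - a) * S (b - x)) := by
    rw [h3]; ring
  rw [this]
  linarith

open Filter Topology ContinuousLinearMap in
theorem comparison_interior {u S C : ℝ → ℝ} {k a b x : ℝ} (hu : ContinuousOn u (Set.Icc 0 1))
    (hdist : ∀ ψ : ℝ → ℝ, ContDiff ℝ (⊤ : ℕ∞) ψ → HasCompactSupport ψ →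
      Function.support ψ ⊆ Set.Ioo 0 1 → (∀ x, 0 ≤ ψ x) →
      (∫ x in Set.Ioo (0:ℝ) 1, u x * deriv (deriv ψ) x)
        - k * ∫ x in Set.Ioo (0:ℝ) 1, u x * ψ x ≤ 0)
    (ha : 0 < a) (hb : b < 1) (hx : x ∈ Set.Icc a b)
    (hS : ∀ y, HasDerivAt S (C y) y) (hC : ∀ y, HasDerivAt C (k * S y) y)
    (hS0 : S 0 = 0) (hC0 : 0 < C 0)
    (hadd : ∀ y z, S y * C z + C y * S z = C 0 * S (y + z))
    (hpos : ∀ y ∈ Set.Icc 0 (b - a), 0 ≤ S y) :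
    u a * S (b - x) + u b * S (x - a) ≤ u x * S (b - a) := by
  have hab : a ≤ b := hx.1.trans hx.2
  set f : ℝ → ℝ := (Set.Ioo (0:ℝ) 1).indicator u with hf
  have hfi : Integrable f := (integrable_indicator_iff measurableSet_Ioo).2
    ((hu.integrableOn_Icc).mono_set Set.Ioo_subset_Icc_self)
  let ρ : ℕ → ContDiffBump (0 : ℝ) := fun n ↦
    ⟨1 / ((n : ℝ) + 1) / 2, 1 / ((n : ℝ) + 1), by positivity, half_lt_self (by positivity)⟩
  have hρ : Tendsto (fun n ↦ (ρ n).rOut) atTop (𝓝 0) := tendsto_one_div_add_atTop_nhds_zero_nat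
  have hlim : ∀ y ∈ Set.Icc a b,
      Tendsto (fun n ↦ convolution ((ρ n).normed volume) f (lsmul ℝ ℝ) volume y) atTop
        (𝓝 (u y)) := fun y hy ↦ by
    have hy' : Set.Ioo (0:ℝ) 1 ∈ 𝓝 y := Ioo_mem_nhds (ha.trans_le hy.1) (hy.2.trans_lt hb)
    have hfy : Tendsto f (𝓝 y) (𝓝 (u y)) := by
      have : Tendsto u (𝓝 y) (𝓝 (u y)) :=
        hu.continuousAt (mem_of_superset hy' Set.Ioo_subset_Icc_self)
      refine this.congr' ?_
      filter_upwards [hy'] with z hz using (Set.indicator_of_mem hz u).symm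
    exact ContDiffBump.convolution_tendsto_right (g := fun _ ↦ f) hρ
      (.of_forall fun _ ↦ hfi.aestronglyMeasurable) (hfy.comp tendsto_snd) tendsto_const_nhds
  refine le_of_tendsto_of_tendsto
    (((hlim a (Set.left_mem_Icc.2 hab)).mul_const _).add
      ((hlim b (Set.right_mem_Icc.2 hab)).mul_const _)) ((hlim x hx).mul_const _) ?_
  filter_upwards [hρ.eventually_lt_const (show 0 < min a (1 - b) from lt_min ha (by linarith))]
    with n hn
  set η := (ρ n).normed volume with hη
  have hη0 : ContDiff ℝ (⊤ : ℕ∞) η := (ρ n).contDiff_normed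
  have hη1 : ContDiff ℝ (⊤ : ℕ∞) (deriv η) := (contDiff_infty_iff_deriv.1 hη0).2
  have hηc : HasCompactSupport η := (ρ n).hasCompactSupport_normed
  refine sturm_comparison hx
    (fun y _ ↦ hηc.hasDerivAt_convolution_left (lsmul ℝ ℝ) (hη0.of_le (by simp))
      hfi.locallyIntegrable y)
    (fun y _ ↦ hηc.deriv.hasDerivAt_convolution_left (lsmul ℝ ℝ) (hη1.of_le (by simp))
      hfi.locallyIntegrable y)
    (fun y hy ↦ ?_) hS hC hS0 hC0 hadd hpos
  have hconv : ∀ g : ℝ → ℝ, convolution g f (lsmul ℝ ℝ) volume y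
      = ∫ t in Set.Ioo (0:ℝ) 1, u t * g (y - t) := fun g ↦ by
    rw [convolution_lsmul_swap, ← integral_indicator measurableSet_Ioo]
    refine integral_congr_ae (.of_forall fun t ↦ ?_)
    by_cases ht : t ∈ Set.Ioo (0:ℝ) 1 <;> simp [hf, ht, mul_comm]
  have hd := hdist (fun t ↦ η (y - t)) (hη0.comp (contDiff_const.sub contDiff_id))
    (hηc.comp_homeomorph (Homeomorph.subLeft y)) (fun t ht ↦ ?_) (fun t ↦ (ρ n).nonneg_normed _)
  · rw [hconv, hconv]
    have : deriv (deriv fun t ↦ η (y - t)) = fun t ↦ deriv (deriv η) (y - t) := by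
      have h1 : (deriv fun t ↦ η (y - t)) = fun t ↦ -deriv η (y - t) :=
        funext fun t ↦ deriv_comp_const_sub ..
      rw [h1]
      funext t
      rw [deriv.fun_neg, deriv_comp_const_sub, neg_neg]
    rw [this] at hd
    linarith
  · have ht' : y - t ∈ Metric.ball (0 : ℝ) (ρ n).rOut := by
      rw [← (ρ n).support_normed_eq (μ := volume)]
      exact ht
    rw [mem_ball_zero_iff, Real.norm_eq_abs, abs_lt] at ht'
    have h1 := hn.trans_le (min_le_left _ _)
    have h2 := hn.trans_le (min_le_right _ _)
    constructor <;> linarith [hy.1, hy.2]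

open Filter Topology in
theorem comparison_Icc {u S C : ℝ → ℝ} {k a b x : ℝ} (hu : ContinuousOn u (Set.Icc 0 1))
    (hdist : ∀ ψ : ℝ → ℝ, ContDiff ℝ (⊤ : ℕ∞) ψ → HasCompactSupport ψ →
      Function.support ψ ⊆ Set.Ioo 0 1 → (∀ x, 0 ≤ ψ x) →
      (∫ x in Set.Ioo (0:ℝ) 1, u x * deriv (deriv ψ) x)
        - k * ∫ x in Set.Ioo (0:ℝ) 1, u x * ψ x ≤ 0)
    (ha : 0 ≤ a) (hb : b ≤ 1) (hx : x ∈ Set.Icc a b)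
    (hS : ∀ y, HasDerivAt S (C y) y) (hC : ∀ y, HasDerivAt C (k * S y) y)
    (hS0 : S 0 = 0) (hC0 : 0 < C 0)
    (hadd : ∀ y z, S y * C z + C y * S z = C 0 * S (y + z))
    (hpos : ∀ y ∈ Set.Icc 0 (b - a), 0 ≤ S y) :
    u a * S (b - x) + u b * S (x - a) ≤ u x * S (b - a) := by
  have hab : a ≤ b := hx.1.trans hx.2
  have hSc : Continuous S := continuous_iff_continuousAt.2 fun y ↦ (hS y).continuousAt
  let T : ℝ → ℝ → ℝ := fun δ y ↦ (1 - δ) * y + δ / 2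
  have hT : ∀ y, Tendsto (fun δ ↦ T δ y) (𝓝[>] 0) (𝓝 y) := fun y ↦ by
    have : Continuous fun δ ↦ T δ y := by fun_prop
    simpa [T] using (this.tendsto 0).mono_left nhdsWithin_le_nhds
  have hδ : ∀ᶠ δ : ℝ in 𝓝[>] 0, δ ∈ Set.Ioo (0:ℝ) 1 := Ioo_mem_nhdsGT one_pos
  have hTm : ∀ δ ∈ Set.Ioo (0:ℝ) 1, ∀ y ∈ Set.Icc (0:ℝ) 1, T δ y ∈ Set.Ioo (0:ℝ) 1 :=
    fun δ hδ y hy ↦ by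
      constructor <;> simp only [T] <;> nlinarith [hδ.1, hδ.2, hy.1, hy.2]
  have hlim : ∀ y ∈ Set.Icc (0:ℝ) 1, Tendsto (fun δ ↦ u (T δ y)) (𝓝[>] 0) (𝓝 (u y)) :=
    fun y hy ↦ (hu y hy).tendsto.comp (tendsto_nhdsWithin_iff.2 ⟨hT y, by
      filter_upwards [hδ] with δ hδ using Set.Ioo_subset_Icc_self (hTm δ hδ y hy)⟩)
  have hlimS : ∀ y z, Tendsto (fun δ ↦ S (T δ y - T δ z)) (𝓝[>] 0) (𝓝 (S (y - z))) :=
    fun y z ↦ (hSc.tendsto _).comp ((hT y).sub (hT z))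
  have ham : a ∈ Set.Icc (0:ℝ) 1 := ⟨ha, hab.trans hb⟩
  have hbm : b ∈ Set.Icc (0:ℝ) 1 := ⟨ha.trans hab, hb⟩
  have hxm : x ∈ Set.Icc (0:ℝ) 1 := ⟨ha.trans hx.1, hx.2.trans hb⟩
  refine le_of_tendsto_of_tendsto (((hlim a ham).mul (hlimS b x)).add
    ((hlim b hbm).mul (hlimS x a))) ((hlim x hxm).mul (hlimS b a)) ?_
  filter_upwards [hδ] with δ hδ
  refine comparison_interior hu hdist (hTm δ hδ a ham).1 (hTm δ hδ b hbm).2 ⟨?_, ?_⟩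
    hS hC hS0 hC0 hadd fun y hy ↦ hpos y ⟨hy.1, hy.2.trans ?_⟩
  all_goals simp only [T]; nlinarith [hδ.1, hδ.2, hx.1, hx.2]

theorem comparison_convexCombination {u : ℝ → ℝ} {κ L : ℝ} (hL : 0 < L)
    (hu : ContinuousOn u (Set.Icc 0 1)) (hupos : ∀ x ∈ Set.Icc (0:ℝ) 1, 0 < u x)
    (hdist : ∀ ψ : ℝ → ℝ, ContDiff ℝ (⊤ : ℕ∞) ψ → HasCompactSupport ψ →
      Function.support ψ ⊆ Set.Ioo 0 1 → (∀ x, 0 ≤ ψ x) →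
      (∫ x in Set.Ioo (0:ℝ) 1, u x * deriv (deriv ψ) x)
        - κ * L ^ 2 * ∫ x in Set.Ioo (0:ℝ) 1, u x * ψ x ≤ 0)
    {a b s : ℝ} (ha : 0 ≤ a) (hab : a < b) (hb : b ≤ 1) (hs : s ∈ Set.Icc (0:ℝ) 1) :
    sigmaCoeff (-κ) (1 - s) ((b - a) * L) * u a + sigmaCoeff (-κ) s ((b - a) * L) * u b
      ≤ u ((1 - s) * a + s * b) := by
  have hba : 0 < b - a := sub_pos.2 hab
  have hθ : (b - a) * L ≠ 0 := by positivity
  have hx : (1 - s) * a + s * b ∈ Set.Icc a b := by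
    constructor <;> nlinarith [hs.1, hs.2]
  have hbx : b - ((1 - s) * a + s * b) = (1 - s) * (b - a) := by ring
  have hxa : (1 - s) * a + s * b - a = s * (b - a) := by ring
  have ham : a ∈ Set.Icc (0:ℝ) 1 := ⟨ha, hab.le.trans hb⟩
  have hbm : b ∈ Set.Icc (0:ℝ) 1 := ⟨ha.trans hab.le, hb⟩
  rcases lt_trichotomy κ 0 with hκ | rfl | hκ
  · set ω := √(-κ) * L with hω
    have hω0 : 0 < ω := mul_pos (Real.sqrt_pos.2 (by linarith)) hL
    have hω2 : ω ^ 2 = -(κ * L ^ 2) := by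
      rw [hω, mul_pow, Real.sq_sqrt (by linarith)]; ring
    have key : ∀ {a b x : ℝ}, 0 ≤ a → b ≤ 1 → x ∈ Set.Icc a b → ω * (b - a) ≤ π →
        u a * sin (ω * (b - x)) + u b * sin (ω * (x - a)) ≤ u x * sin (ω * (b - a)) :=
      fun ha hb hx h ↦ by
        refine comparison_Icc (S := fun y ↦ sin (ω * y)) (C := fun y ↦ ω * cos (ω * y)) hu hdist
          ha hb hx (fun y ↦ ?_) (fun y ↦ ?_) (by simp) (by simpa) (fun y z ↦ ?_) (fun y hy ↦ ?_)
        · exact ((hasDerivAt_id y).const_mul ω).sin.congr_deriv (by simp [mul_comm])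
        · refine (((hasDerivAt_id y).const_mul ω).cos.const_mul ω).congr_deriv ?_
          rw [show κ * L ^ 2 = -ω ^ 2 by rw [hω2]; ring]
          simp; ring
        · simp only [mul_zero, cos_zero, mul_add, sin_add]; ring
        · exact sin_nonneg_of_nonneg_of_le_pi (mul_nonneg hω0.le hy.1)
            ((mul_le_mul_of_nonneg_left hy.2 hω0.le).trans h)
    have hωπ : ω < π := by
      by_contra! h
      have hℓ : π / ω ≤ 1 := (div_le_one hω0).2 h
      have hℓ0 : 0 < π / ω := by positivity
      have h1 := key (a := 0) (b := π / ω) (x := π / ω / 2) le_rfl hℓ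
        ⟨by positivity, by linarith⟩ (by rw [sub_zero, mul_div_cancel₀ _ hω0.ne'])
      rw [show ω * (π / ω - π / ω / 2) = π / 2 by field_simp; ring,
        show ω * (π / ω / 2 - 0) = π / 2 by field_simp; ring,
        show ω * (π / ω - 0) = π by field_simp; ring, sin_pi, sin_pi_div_two] at h1
      linarith [hupos 0 (by simp), hupos (π / ω) ⟨hℓ0.le, hℓ⟩]
    have hlt : ω * (b - a) < π := by nlinarith
    have h := key ha hb hx hlt.le
    rw [hbx, hxa] at h
    have hsin : 0 < sin (ω * (b - a)) := sin_pos_of_pos_of_lt_pi (by positivity) hlt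
    have hσ : ∀ t, sigmaCoeff (-κ) t ((b - a) * L)
        = sin (ω * (t * (b - a))) / sin (ω * (b - a)) := fun t ↦ by
      rw [sigmaCoeff, if_neg hθ, if_pos (by linarith)]
      congr 2 <;> rw [hω] <;> ring
    rw [hσ, hσ, div_mul_eq_mul_div, div_mul_eq_mul_div, ← add_div, div_le_iff₀ hsin]
    linarith
  · have h := comparison_Icc (S := fun y ↦ y) (C := fun _ ↦ 1) hu hdist ha hb hx
      (fun y ↦ hasDerivAt_id y) (fun y ↦ by simpa using hasDerivAt_const y (1:ℝ))
      rfl one_pos (fun y z ↦ by ring) (fun y hy ↦ hy.1)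
    simp only [hbx, hxa] at h
    simp only [sigmaCoeff, neg_zero, lt_irrefl, if_false, ite_self]
    refine le_of_mul_le_mul_right ?_ hba
    linarith
  · set ω := √κ * L with hω
    have hω0 : 0 < ω := mul_pos (Real.sqrt_pos.2 hκ) hL
    have hω2 : ω ^ 2 = κ * L ^ 2 := by rw [hω, mul_pow, Real.sq_sqrt hκ.le]
    have h : u a * sinh (ω * (b - ((1 - s) * a + s * b)))
        + u b * sinh (ω * ((1 - s) * a + s * b - a))
        ≤ u ((1 - s) * a + s * b) * sinh (ω * (b - a)) := by
      refine comparison_Icc (S := fun y ↦ sinh (ω * y)) (C := fun y ↦ ω * cosh (ω * y)) hu hdist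
        ha hb hx (fun y ↦ ?_) (fun y ↦ ?_) (by simp) (by simpa) (fun y z ↦ ?_) (fun y hy ↦ ?_)
      · exact ((hasDerivAt_id y).const_mul ω).sinh.congr_deriv (by simp [mul_comm])
      · refine (((hasDerivAt_id y).const_mul ω).cosh.const_mul ω).congr_deriv ?_
        rw [← hω2]
        simp; ring
      · simp only [mul_zero, cosh_zero, mul_add, sinh_add]; ring
      · exact sinh_nonneg_iff.2 (mul_nonneg hω0.le hy.1)
    rw [hbx, hxa] at h
    have hsinh : 0 < sinh (ω * (b - a)) := sinh_pos_iff.2 (by positivity)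
    have hσ : ∀ t, sigmaCoeff (-κ) t ((b - a) * L)
        = sinh (ω * (t * (b - a))) / sinh (ω * (b - a)) := fun t ↦ by
      rw [sigmaCoeff, if_neg hθ, if_neg (by linarith), if_pos (by linarith), neg_neg]
      congr 2 <;> rw [hω] <;> ring
    rw [hσ, hσ, div_mul_eq_mul_div, div_mul_eq_mul_div, ← add_div, div_le_iff₀ hsinh]
    linarith

/-- if `φ : [0,1] → (0,∞)` is continuous and `u := φ^{1/(N−1)}`
satisfies `u'' − κ·L²·u ≤ 0` distributionally on `(0,1)`, then for all
`t₀, t₁, s ∈ [0,1]`,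
`φ((1−s)t₀+st₁)^{1/(N−1)} ≥ σ_{−κ}^{(1−s)}(|t₁−t₀|L)·φ(t₀)^{1/(N−1)}
 + σ_{−κ}^{(s)}(|t₁−t₀|L)·φ(t₁)^{1/(N−1)}`. -/
theorem stmt2 (κ L N : ℝ) (hL : 0 < L) (hN : 1 < N)
    (φ : ℝ → ℝ)
    (hφcont : ContinuousOn φ (Set.Icc 0 1))
    (hφpos : ∀ x ∈ Set.Icc (0:ℝ) 1, 0 < φ x)
    (hdist : ∀ ψ : ℝ → ℝ, ContDiff ℝ (⊤ : ℕ∞) ψ → HasCompactSupport ψ →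
      Function.support ψ ⊆ Set.Ioo 0 1 → (∀ x, 0 ≤ ψ x) →
      (∫ x in Set.Ioo (0:ℝ) 1, (φ x ^ ((1:ℝ)/(N-1))) * deriv (deriv ψ) x)
        - κ * L ^ 2 * ∫ x in Set.Ioo (0:ℝ) 1, (φ x ^ ((1:ℝ)/(N-1))) * ψ x ≤ 0) :
    ∀ t₀ ∈ Set.Icc (0:ℝ) 1, ∀ t₁ ∈ Set.Icc (0:ℝ) 1, ∀ s ∈ Set.Icc (0:ℝ) 1,
      φ ((1 - s) * t₀ + s * t₁) ^ ((1:ℝ)/(N-1)) ≥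
        sigmaCoeff (-κ) (1 - s) (|t₁ - t₀| * L) * φ t₀ ^ ((1:ℝ)/(N-1))
          + sigmaCoeff (-κ) s (|t₁ - t₀| * L) * φ t₁ ^ ((1:ℝ)/(N-1)) := by
  have hupos : ∀ x ∈ Set.Icc (0:ℝ) 1, 0 < φ x ^ ((1:ℝ)/(N-1)) :=
    fun x hx ↦ rpow_pos_of_pos (hφpos x hx) _
  have hu : ContinuousOn (fun x ↦ φ x ^ ((1:ℝ)/(N-1))) (Set.Icc 0 1) :=
    hφcont.rpow_const fun x hx ↦ Or.inl (hφpos x hx).ne'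
  intro t₀ h₀ t₁ h₁ s hs
  rcases lt_trichotomy t₀ t₁ with h | rfl | h
  · rw [abs_of_pos (sub_pos.2 h)]
    exact comparison_convexCombination hL hu hupos hdist h₀.1 h h₁.2 hs
  · rw [show (1 - s) * t₀ + s * t₀ = t₀ by ring]
    simp only [sigmaCoeff, sub_self, abs_zero, zero_mul, if_true]
    linarith
  · rw [abs_of_neg (sub_neg.2 h), neg_sub]
    have := comparison_convexCombination hL hu hupos hdist h₁.1 h h₀.2
      (s := 1 - s) ⟨by linarith [hs.2], by linarith [hs.1]⟩
    rw [sub_sub_cancel, add_comm (s * t₁), add_comm (sigmaCoeff _ s _ * _)] at this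
    exact this
end

section
/- Let h : (a,b) → (0,∞) be continuous and satisfy the distributional inequality (h^{1/(N−1)})'' + η·h^{1/(N−1)} ≤ 0 on (a,b), where N > 1 and η ∈ ℝ. Then h is locally Lipschitz continuous on (a,b). -/
open MeasureTheory

open Set Filter Topology Convolution ContinuousLinearMap in
/-- If `U` is continuous on `(p, q)` and every mollification of `U` at a small enough scale has
second derivative at most `C` on `(p, q)`, then `U - C y² / 2` is concave on `(p, q)`. -/
theorem concaveOn_sub_sq_of_integral_mul_deriv2_le {U : ℝ → ℝ} {p q C ρ : ℝ}
    (hU : LocallyIntegrable U) (hUc : ContinuousOn U (Ioo p q)) (hρ : 0 < ρ)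
    (hd : ∀ φ : ContDiffBump (0 : ℝ), φ.rOut < ρ → ∀ y ∈ Ioo p q,
      ∫ t, U t * deriv (deriv (φ.normed volume)) (y - t) ≤ C) :
    ConcaveOn ℝ (Ioo p q) (fun y => U y - C / 2 * y ^ 2) := by
  have hmoll : ∀ φ : ContDiffBump (0 : ℝ), φ.rOut < ρ →
      ConcaveOn ℝ (Ioo p q)
        (fun y => (U ⋆[lsmul ℝ ℝ, volume] φ.normed volume) y - C / 2 * y ^ 2) := by
    intro φ hφ
    set f := φ.normed (volume : Measure ℝ) with hf
    have hfs : ContDiff ℝ (⊤ : ℕ∞) f := φ.contDiff_normed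
    have hfs' : ContDiff ℝ (⊤ : ℕ∞) (deriv f) := (contDiff_infty_iff_deriv.1 hfs).2
    have hfc : HasCompactSupport f := φ.hasCompactSupport_normed
    have h1 : ∀ y, HasDerivAt
        (fun y => (U ⋆[lsmul ℝ ℝ, volume] f) y - C / 2 * y ^ 2)
        ((U ⋆[lsmul ℝ ℝ, volume] deriv f) y - C * y) y := by
      intro y
      have hA := hfc.hasDerivAt_convolution_right (lsmul ℝ ℝ) hU (hfs.of_le (by simp)) y
      have hB := ((hasDerivAt_id y).pow 2).const_mul (C / 2)
      exact (hA.fun_sub hB).congr_deriv (by simp; ring)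
    have h2 : ∀ y, HasDerivAt (fun y => (U ⋆[lsmul ℝ ℝ, volume] deriv f) y - C * y)
        ((U ⋆[lsmul ℝ ℝ, volume] deriv (deriv f)) y - C) y := by
      intro y
      have hA := hfc.deriv.hasDerivAt_convolution_right (lsmul ℝ ℝ) hU (hfs'.of_le (by simp)) y
      have hB := (hasDerivAt_id y).const_mul C
      exact (hA.fun_sub hB).congr_deriv (by simp)
    have hderiv := funext fun y => (h1 y).deriv
    refine concaveOn_of_deriv2_nonpos' (convex_Ioo p q)
      (fun y _ => (h1 y).differentiableAt.differentiableWithinAt)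
      (fun y _ => ?_) (fun y hy => ?_)
    · rw [hderiv]
      exact (h2 y).differentiableAt.differentiableWithinAt
    · simp only [Function.iterate_succ, Function.iterate_zero, Function.comp_apply, id]
      rw [hderiv, (h2 y).deriv]
      have := hd φ hφ y hy
      simp only [convolution_def, lsmul_apply, smul_eq_mul]
      linarith
  let φ : ℕ → ContDiffBump (0 : ℝ) := fun n =>
    { rIn := 1 / ((n + 1 : ℕ) + 1 : ℝ)
      rOut := 1 / (n + 1 : ℝ)
      rIn_pos := by positivity
      rIn_lt_rOut := by
        apply one_div_lt_one_div_of_lt <;> push_cast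
        · positivity
        · linarith }
  have hφ0 : Tendsto (fun n => (φ n).rOut) atTop (𝓝 0) := tendsto_one_div_add_atTop_nhds_zero_nat
  have hlim : ∀ y ∈ Ioo p q, Tendsto
      (fun n => (U ⋆[lsmul ℝ ℝ, volume] (φ n).normed volume) y - C / 2 * y ^ 2) atTop
      (𝓝 (U y - C / 2 * y ^ 2)) := by
    intro y hy
    refine Tendsto.sub_const ?_ _
    have hUy : ContinuousAt U y := hUc.continuousAt (isOpen_Ioo.mem_nhds hy)
    have := ContDiffBump.convolution_tendsto_right (μ := volume) (g := fun _ => U)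
      (k := fun _ : ℕ => y) hφ0
      (Eventually.of_forall fun _ => hU.aestronglyMeasurable) (hUy.tendsto.comp tendsto_snd)
      tendsto_const_nhds
    refine this.congr fun n => ?_
    simp only [convolution_eq_swap (lsmul ℝ ℝ) (f := (φ n).normed volume), convolution_def,
      lsmul_apply, smul_eq_mul, mul_comm]
  refine ⟨convex_Ioo p q, fun x hx y hy s t hs ht hst => ?_⟩
  refine le_of_tendsto_of_tendsto (((hlim x hx).const_smul s).add ((hlim y hy).const_smul t))
    (hlim _ (convex_Ioo p q hx hy hs ht hst)) ?_
  filter_upwards [hφ0.eventually_lt_const hρ] with n hn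
  exact (hmoll (φ n) hn).2 hx hy hs ht hst

open Set Filter Topology in
/-- A continuous function `u` satisfying `u'' + η u ≤ 0` in the distributional sense is locally
semiconcave. -/
theorem exists_concaveOn_sub_sq_of_distributional {a b η : ℝ} {u : ℝ → ℝ}
    (hu : ContinuousOn u (Ioo a b))
    (hdist : ∀ ψ : ℝ → ℝ, ContDiff ℝ (⊤ : ℕ∞) ψ → HasCompactSupport ψ →
      Function.support ψ ⊆ Ioo a b → (∀ x, 0 ≤ ψ x) →
      (∫ x in Ioo a b, u x * deriv (deriv ψ) x) + η * ∫ x in Ioo a b, u x * ψ x ≤ 0)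
    {x : ℝ} (hx : x ∈ Ioo a b) :
    ∃ δ > 0, ∃ C : ℝ, ConcaveOn ℝ (Ioo (x - δ) (x + δ)) (fun y => u y - C / 2 * y ^ 2) := by
  obtain ⟨δ, hδ, hxa, hxb⟩ : ∃ δ > 0, a < x - 2 * δ ∧ x + 2 * δ < b := by
    refine ⟨min (x - a) (b - x) / 3, ?_, ?_, ?_⟩
    · have := lt_min (sub_pos.2 hx.1) (sub_pos.2 hx.2)
      positivity
    · linarith [min_le_left (x - a) (b - x), hx.1]
    · linarith [min_le_right (x - a) (b - x), hx.2]
  set K := Icc (x - 2 * δ) (x + 2 * δ) with hK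
  have hKab : K ⊆ Ioo a b := fun y hy => ⟨hxa.trans_le hy.1, hy.2.trans_lt hxb⟩
  have huK : ContinuousOn u K := hu.mono hKab
  obtain ⟨M, hM⟩ := isCompact_Icc.exists_bound_of_continuousOn huK
  set U := K.indicator u with hUdef
  have hUint : Integrable U :=
    (huK.integrableOn_compact isCompact_Icc).integrable_indicator measurableSet_Icc
  have hUu : EqOn U u K := fun y hy => indicator_of_mem hy u
  have hsub : Ioo (x - δ) (x + δ) ⊆ K := fun y hy => ⟨by linarith [hy.1], by linarith [hy.2]⟩
  have hUM : ∀ t, |U t| ≤ M := by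
    intro t
    by_cases ht : t ∈ K
    · rw [hUu ht]; exact hM t ht
    · rw [hUdef, indicator_of_notMem ht, abs_zero]
      exact (norm_nonneg _).trans (hM x ⟨by linarith, by linarith⟩)
  have hset : ∀ F : ℝ → ℝ, (∀ t ∉ K, F t = 0) →
      ∫ t in Ioo a b, u t * F t = ∫ t, U t * F t := by
    intro F hF
    rw [setIntegral_eq_integral_of_forall_compl_eq_zero
      (fun t ht => by rw [hF t (fun h => ht (hKab h)), mul_zero])]
    refine integral_congr_ae (Eventually.of_forall fun t => ?_)
    by_cases ht : t ∈ K
    · simp only [hUu ht]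
    · simp only [hF t ht, mul_zero]
  refine ⟨δ, hδ, |η| * M, ?_⟩
  have key := concaveOn_sub_sq_of_integral_mul_deriv2_le (C := |η| * M) hUint.locallyIntegrable
    ((huK.mono hsub).congr (hUu.mono hsub)) hδ ?_
  · exact key.congr fun y hy => by simp only [hUu (hsub hy)]
  intro φ hφ y hy
  set f := φ.normed (volume : Measure ℝ) with hf
  set ψ : ℝ → ℝ := fun t => f (y - t) with hψ
  have hfs : ContDiff ℝ (⊤ : ℕ∞) f := φ.contDiff_normed
  have hψs : ContDiff ℝ (⊤ : ℕ∞) ψ := hfs.comp (contDiff_const.sub contDiff_id)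
  have hψK : ∀ t ∉ K, f (y - t) = 0 ∧ deriv (deriv f) (y - t) = 0 := by
    intro t ht
    have hnot : y - t ∉ tsupport f := by
      rw [hf, φ.tsupport_normed_eq, Metric.mem_closedBall, dist_zero_right, Real.norm_eq_abs]
      intro hle
      have := abs_le.1 hle
      exact ht ⟨by linarith [hy.1], by linarith [hy.2]⟩
    exact ⟨image_eq_zero_of_notMem_tsupport hnot, image_eq_zero_of_notMem_tsupport
      fun h => hnot (tsupport_deriv_subset (tsupport_deriv_subset h))⟩
  have hψsupp : Function.support ψ ⊆ K := fun t ht => by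
    by_contra hn
    exact ht (hψK t hn).1
  have hψ2 : deriv (deriv ψ) = fun t => deriv (deriv f) (y - t) := by
    have h1 : deriv ψ = fun t => -deriv f (y - t) := funext fun t => deriv_comp_const_sub ..
    rw [h1]
    funext t
    rw [deriv.fun_neg, deriv_comp_const_sub, neg_neg]
  have hineq := hdist ψ hψs (HasCompactSupport.of_support_subset_isCompact isCompact_Icc hψsupp)
    (hψsupp.trans hKab) (fun t => φ.nonneg_normed _)
  rw [hψ2, hset _ fun t ht => (hψK t ht).2, hset _ fun t ht => (hψK t ht).1] at hineq
  have hψint : Integrable ψ := φ.integrable_normed.comp_sub_left y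
  have hbound : |∫ t, U t * ψ t| ≤ M := by
    have hone : ∫ t, ψ t = 1 := by
      rw [hψ, integral_sub_left_eq_self f volume y]
      exact φ.integral_normed
    calc |∫ t, U t * ψ t| ≤ ∫ t, M * ψ t := by
          rw [← Real.norm_eq_abs]
          refine norm_integral_le_of_norm_le (hψint.const_mul M) (Eventually.of_forall fun t => ?_)
          rw [Real.norm_eq_abs, abs_mul, abs_of_nonneg (φ.nonneg_normed _ : 0 ≤ ψ t)]
          exact mul_le_mul_of_nonneg_right (hUM t) (φ.nonneg_normed _)
      _ = M := by rw [integral_const_mul, hone, mul_one]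
  have habs : |η * ∫ t, U t * ψ t| ≤ |η| * M := by
    rw [abs_mul]
    exact mul_le_mul_of_nonneg_left hbound (abs_nonneg η)
  linarith [neg_le_of_abs_le habs]

/-- if `h : (a,b) → (0,∞)` is continuous and `h^{1/(N−1)}` satisfies
`(h^{1/(N−1)})'' + η·h^{1/(N−1)} ≤ 0` in the distributional sense on `(a,b)`
(`N > 1`, `η ∈ ℝ`), then `h` is locally Lipschitz continuous on `(a,b)`. -/
theorem stmt3 (a b N η : ℝ) (hN : 1 < N) (h : ℝ → ℝ)
    (hcont : ContinuousOn h (Set.Ioo a b))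
    (hpos : ∀ x ∈ Set.Ioo a b, 0 < h x)
    (hdist : ∀ ψ : ℝ → ℝ, ContDiff ℝ (⊤ : ℕ∞) ψ → HasCompactSupport ψ →
      Function.support ψ ⊆ Set.Ioo a b → (∀ x, 0 ≤ ψ x) →
      (∫ x in Set.Ioo a b, (h x ^ ((1:ℝ)/(N-1))) * deriv (deriv ψ) x)
        + η * ∫ x in Set.Ioo a b, (h x ^ ((1:ℝ)/(N-1))) * ψ x ≤ 0) :
    ∀ x ∈ Set.Ioo a b, ∃ ε > 0, ∃ K : NNReal,
      Set.Ioo (x - ε) (x + ε) ⊆ Set.Ioo a b ∧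
      LipschitzOnWith K h (Set.Ioo (x - ε) (x + ε)) := by
  intro x hx
  set p : ℝ := 1 / (N - 1)
  have hN' : N - 1 ≠ 0 := by linarith
  have hucont : ContinuousOn (fun y => h y ^ p) (Set.Ioo a b) :=
    hcont.rpow_const fun y hy => Or.inl (hpos y hy).ne'
  obtain ⟨δ, hδ, C, hconc⟩ := exists_concaveOn_sub_sq_of_distributional hucont hdist hx
  have hxδ : x ∈ Set.Ioo (x - δ) (x + δ) := ⟨by linarith, by linarith⟩
  have hlip := hconc.locallyLipschitzOn isOpen_Ioo
  obtain ⟨K₁, s₁, hs₁, hL₁⟩ := hlip hxδ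
  rw [isOpen_Ioo.nhdsWithin_eq hxδ] at hs₁
  have hquad : ContDiffAt ℝ 1 (fun y : ℝ => C / 2 * y ^ 2) x := by fun_prop
  obtain ⟨K₂, s₂, hs₂, hL₂⟩ := hquad.exists_lipschitzOnWith
  have hpow : ContDiffAt ℝ 1 (fun z : ℝ => z ^ (N - 1)) (h x ^ p) :=
    Real.contDiffAt_rpow_const_of_ne (Real.rpow_pos_of_pos (hpos x hx) p).ne'
  obtain ⟨K₃, s₃, hs₃, hL₃⟩ := hpow.exists_lipschitzOnWith
  have hnhds := isOpen_Ioo.mem_nhds hx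
  have hs₃' := (hucont.continuousAt hnhds).preimage_mem_nhds hs₃
  obtain ⟨ε, hε, hball⟩ := Metric.mem_nhds_iff.1
    (Filter.inter_mem (Filter.inter_mem hs₁ hs₂) (Filter.inter_mem hs₃' hnhds))
  rw [Real.ball_eq_Ioo] at hball
  refine ⟨ε, hε, K₃ * (K₁ + K₂), fun y hy => (hball hy).2.2, ?_⟩
  have hu := (hL₁.mono fun y hy => (hball hy).1.1).add (hL₂.mono fun y hy => (hball hy).1.2)
  simp only [sub_add_cancel] at hu
  have hcomp := hL₃.comp hu fun y hy => (hball hy).2.1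
  have heq : Set.EqOn h ((fun z : ℝ => z ^ (N - 1)) ∘ fun y => h y ^ p)
      (Set.Ioo (x - ε) (x + ε)) := fun y hy => by
    have hy0 := hpos y (hball hy).2.2
    simp only [Function.comp_apply]
    rw [← Real.rpow_mul hy0.le, one_div_mul_cancel hN', Real.rpow_one]
  intro y hy z hz
  rw [heq hy, heq hz]
  exact hcomp hy hz
end

section
/- Let h : [a,b] → [0,∞) be continuous with h > 0 on (a,b), N > 1, η ∈ ℝ, and suppose (h^{1/(N−1)})'' + η·h^{1/(N−1)} ≤ 0 distributionally on (a,b). Then for every r₀ ∈ (a,b) there exists a constant C and a neighbourhood U of r₀ such that r ↦ h(r) − C·r² is concave on U (i.e., h is locally semi-concave on (a,b)). -/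
open MeasureTheory

open scoped Convolution Topology

theorem hasCompactSupport_comp_const_sub {ρ : ℝ → ℝ} (hρ : HasCompactSupport ρ)
    (x : ℝ) : HasCompactSupport (fun t => ρ (x - t)) :=
  hρ.comp_homeomorph (Homeomorph.subLeft x)

theorem deriv_deriv_comp_const_sub (ρ : ℝ → ℝ) (x : ℝ) :
    deriv (deriv fun t => ρ (x - t)) = fun t => deriv (deriv ρ) (x - t) := by
  have h1 : ∀ f : ℝ → ℝ, (deriv fun t => f (x - t)) = fun t => -deriv f (x - t) := fun f => by
    funext t
    exact deriv_comp_const_sub f x t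
  rw [h1]
  funext t
  rw [deriv.fun_neg, h1 (deriv ρ), neg_neg]

/-- A continuous function on `[a, b]` whose distributional second derivative is bounded above by
`-η u` is semi-concave, with a constant controlled by a bound on `|u|`. -/
theorem concaveOn_sub_sq_of_distributional {a b η M : ℝ} {u : ℝ → ℝ} (hab : a ≤ b)
    (hu : ContinuousOn u (Set.Icc a b)) (hM : ∀ x ∈ Set.Icc a b, |u x| ≤ M)
    (hdist : ∀ ψ : ℝ → ℝ, ContDiff ℝ (⊤ : ℕ∞) ψ → HasCompactSupport ψ →
      Function.support ψ ⊆ Set.Ioo a b → (∀ x, 0 ≤ ψ x) →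
      (∫ x in Set.Ioo a b, u x * deriv (deriv ψ) x)
        + η * ∫ x in Set.Ioo a b, u x * ψ x ≤ 0) :
    ConcaveOn ℝ (Set.Ioo a b) (fun x => u x - |η| * M / 2 * x ^ 2) := by
  set v : ℝ → ℝ := Set.IccExtend hab ((Set.Icc a b).domRestrict u) with hv
  have hvc : Continuous v := hu.domRestrict.Icc_extend'
  have hvM : ∀ x, |v x| ≤ M := fun x => hM _ (Set.projIcc a b hab x).2
  have hvu : ∀ x ∈ Set.Ioo a b, v x = u x := fun x hx =>
    Set.IccExtend_of_mem hab _ (Set.Ioo_subset_Icc_self hx)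
  let φ : ℕ → ContDiffBump (0 : ℝ) := fun n =>
    ⟨1 / ((n : ℝ) + 1) / 2, 1 / ((n : ℝ) + 1), by positivity, half_lt_self (by positivity)⟩
  have hφ : Filter.Tendsto (fun n => (φ n).rOut) Filter.atTop (𝓝 0) :=
    tendsto_one_div_add_atTop_nhds_zero_nat
  let F : ℕ → ℝ → ℝ := fun n =>
    ((φ n).normed volume ⋆[ContinuousLinearMap.lsmul ℝ ℝ, volume] v)
  have hF : ∀ x, Filter.Tendsto (fun n => F n x) Filter.atTop (𝓝 (v x)) := fun x =>
    ContDiffBump.convolution_tendsto_right_of_continuous hφ hvc x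
  have hconc : ∀ n, ConcaveOn ℝ (Set.Ioo (a + (φ n).rOut) (b - (φ n).rOut))
      (fun x => F n x - |η| * M / 2 * x ^ 2) := by
    intro n
    set ρ : ℝ → ℝ := (φ n).normed volume with hρ
    have hρs : ContDiff ℝ (⊤ : ℕ∞) ρ := (φ n).contDiff_normed
    have hρc : HasCompactSupport ρ := (φ n).hasCompactSupport_normed
    have hρ's : ContDiff ℝ (⊤ : ℕ∞) (deriv ρ) := by
      have := (contDiff_infty_iff_deriv (𝕜 := ℝ)).1 hρs
      exact this.2
    have hd1 : ∀ x, HasDerivAt (F n)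
        ((deriv ρ ⋆[ContinuousLinearMap.lsmul ℝ ℝ, volume] v) x) x := fun x =>
      hρc.hasDerivAt_convolution_left _ (hρs.of_le (by exact_mod_cast le_top))
        hvc.locallyIntegrable x
    have hd2 : ∀ x, HasDerivAt (deriv ρ ⋆[ContinuousLinearMap.lsmul ℝ ℝ, volume] v)
        ((deriv (deriv ρ) ⋆[ContinuousLinearMap.lsmul ℝ ℝ, volume] v) x) x := fun x =>
      hρc.deriv.hasDerivAt_convolution_left _ (hρ's.of_le (by exact_mod_cast le_top))
        hvc.locallyIntegrable x
    have hbound : ∀ x ∈ Set.Ioo (a + (φ n).rOut) (b - (φ n).rOut),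
        (deriv (deriv ρ) ⋆[ContinuousLinearMap.lsmul ℝ ℝ, volume] v) x ≤ |η| * M := by
      intro x hx
      set ψ : ℝ → ℝ := fun t => ρ (x - t) with hψ
      have hsupp : Function.support ψ ⊆ Set.Ioo a b := by
        intro t ht
        have : x - t ∈ Function.support ρ := ht
        rw [hρ, (φ n).support_normed_eq, Metric.mem_ball, dist_zero_right, Real.norm_eq_abs,
          abs_lt] at this
        exact ⟨by linarith [hx.1], by linarith [hx.2]⟩
      have hsupp2 : Function.support (deriv (deriv ψ)) ⊆ Set.Icc a b :=
        (support_deriv_subset.trans (closure_mono support_deriv_subset)).trans <| by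
          rw [tsupport, closure_closure]
          exact closure_minimal (hsupp.trans Set.Ioo_subset_Icc_self) isClosed_Icc
      have hψi : ∫ t, ψ t = 1 := by
        rw [hψ, integral_sub_left_eq_self ρ volume x]
        exact (φ n).integral_normed
      have hψint : Integrable ψ := (φ n).integrable_normed.comp_sub_left x
      have hψ0 : ∀ t, 0 ≤ ψ t := fun t => (φ n).nonneg_normed _
      have key := hdist ψ (hρs.comp (contDiff_const.sub contDiff_id))
        (hasCompactSupport_comp_const_sub hρc x) hsupp hψ0
      have e1 : ∫ t in Set.Ioo a b, u t * deriv (deriv ψ) t =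
          (deriv (deriv ρ) ⋆[ContinuousLinearMap.lsmul ℝ ℝ, volume] v) x := by
        rw [convolution_lsmul_swap, setIntegral_congr_fun (g := fun t => v t * deriv (deriv ψ) t)
          measurableSet_Ioo (fun t ht => by simp only [hvu t ht]), ← integral_Icc_eq_integral_Ioo,
          setIntegral_eq_integral_of_forall_compl_eq_zero]
        · refine integral_congr_ae (Filter.Eventually.of_forall fun t => ?_)
          simp only [hψ, deriv_deriv_comp_const_sub, smul_eq_mul, mul_comm]
        · intro t ht
          rw [Function.notMem_support.1 (fun h => ht (hsupp2 h)), mul_zero]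
      have e2 : ∫ t in Set.Ioo a b, u t * ψ t = ∫ t, v t * ψ t := by
        rw [setIntegral_congr_fun (g := fun t => v t * ψ t)
          measurableSet_Ioo (fun t ht => by simp only [hvu t ht]),
          setIntegral_eq_integral_of_forall_compl_eq_zero]
        intro t ht
        rw [Function.notMem_support.1 (fun h => ht (hsupp h)), mul_zero]
      have e3 : |∫ t, v t * ψ t| ≤ M := by
        have := norm_integral_le_of_norm_le (f := fun t => v t * ψ t) (hψint.const_mul M)
          (Filter.Eventually.of_forall fun t => by
            rw [norm_mul, Real.norm_eq_abs, Real.norm_eq_abs, abs_of_nonneg (hψ0 t)]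
            exact mul_le_mul_of_nonneg_right (hvM t) (hψ0 t))
        rwa [integral_const_mul, hψi, mul_one, Real.norm_eq_abs] at this
      rw [e1, e2] at key
      have e4 : |η * ∫ t, v t * ψ t| ≤ |η| * M := by
        rw [abs_mul]; exact mul_le_mul_of_nonneg_left e3 (abs_nonneg _)
      linarith [neg_abs_le (η * ∫ t, v t * ψ t)]
    have hD1 : ∀ x, HasDerivAt (fun x => F n x - |η| * M / 2 * x ^ 2)
        ((deriv ρ ⋆[ContinuousLinearMap.lsmul ℝ ℝ, volume] v) x - |η| * M * x) x := fun x =>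
      ((hd1 x).sub ((hasDerivAt_pow 2 x).const_mul (|η| * M / 2))).congr_deriv (by
        push_cast; ring)
    have hD2 : ∀ x, HasDerivAt (deriv fun x => F n x - |η| * M / 2 * x ^ 2)
        ((deriv (deriv ρ) ⋆[ContinuousLinearMap.lsmul ℝ ℝ, volume] v) x - |η| * M) x := by
      intro x
      rw [show (deriv fun x => F n x - |η| * M / 2 * x ^ 2) = _ from funext fun x => (hD1 x).deriv]
      exact ((hd2 x).sub ((hasDerivAt_id x).const_mul (|η| * M))).congr_deriv (by ring)
    refine concaveOn_of_deriv2_nonpos' (convex_Ioo _ _)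
      (fun x _ => (hD1 x).differentiableAt.differentiableWithinAt)
      (fun x _ => (hD2 x).differentiableAt.differentiableWithinAt) fun x hx => ?_
    rw [Function.iterate_succ, Function.iterate_one, Function.comp_apply, (hD2 x).deriv]
    linarith [hbound x hx]
  refine ⟨convex_Ioo a b, fun x hx y hy s t hs ht hst => ?_⟩
  have hz := convex_Ioo a b hx hy hs ht hst
  have lim : ∀ x ∈ Set.Ioo a b, Filter.Tendsto (fun n => F n x - |η| * M / 2 * x ^ 2)
      Filter.atTop (𝓝 (u x - |η| * M / 2 * x ^ 2)) := fun x hx =>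
    (hvu x hx ▸ hF x).sub_const _
  have hev : ∀ x ∈ Set.Ioo a b, ∀ᶠ n in Filter.atTop,
      x ∈ Set.Ioo (a + (φ n).rOut) (b - (φ n).rOut) := fun x hx => by
    filter_upwards [hφ.eventually_lt_const (sub_pos.2 hx.1),
      hφ.eventually_lt_const (sub_pos.2 hx.2)] with n h1 h2
    exact ⟨by linarith, by linarith⟩
  refine le_of_tendsto_of_tendsto (((lim x hx).const_smul s).add ((lim y hy).const_smul t))
    (lim _ hz) ?_
  filter_upwards [hev x hx, hev y hy] with n hnx hny
  exact (hconc n).2 hnx hny hs ht hst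

/-- Semi-concavity of `w ↦ w ^ p` on compact subintervals of the positive half-line. -/
theorem exists_concaveOn_rpow_sub_sq {m M : ℝ} (hm : 0 < m) (p : ℝ) :
    ∃ L : ℝ, 0 ≤ L ∧ ConcaveOn ℝ (Set.Icc m M) (fun w => w ^ p - L / 2 * w ^ 2) := by
  have hc : ContinuousOn (fun w : ℝ => p * ((p - 1) * w ^ (p - 1 - 1))) (Set.Icc m M) := by
    intro w hw
    have : w ≠ 0 := (hm.trans_le hw.1).ne'
    exact (continuousAt_const.mul (continuousAt_const.mul
      (Real.continuousAt_rpow_const w _ (Or.inl this)))).continuousWithinAt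
  obtain ⟨L, hL⟩ := isCompact_Icc.exists_bound_of_continuousOn hc
  refine ⟨|L|, abs_nonneg L, ?_⟩
  have hD1 : ∀ w : ℝ, 0 < w → HasDerivAt (fun w : ℝ => w ^ p - |L| / 2 * w ^ 2)
      (p * w ^ (p - 1) - |L| * w) w := fun w hw =>
    ((Real.hasDerivAt_rpow_const (Or.inl hw.ne')).sub
      ((hasDerivAt_pow 2 w).const_mul (|L| / 2))).congr_deriv (by push_cast; ring)
  have hD2 : ∀ w : ℝ, 0 < w → HasDerivAt (deriv fun w : ℝ => w ^ p - |L| / 2 * w ^ 2)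
      (p * ((p - 1) * w ^ (p - 1 - 1)) - |L|) w := fun w hw => by
    have : HasDerivAt (fun w : ℝ => p * w ^ (p - 1) - |L| * w)
        (p * ((p - 1) * w ^ (p - 1 - 1)) - |L|) w :=
      (((Real.hasDerivAt_rpow_const (Or.inl hw.ne')).const_mul p).sub
        ((hasDerivAt_id w).const_mul |L|)).congr_deriv (by ring)
    refine this.congr_of_eventuallyEq ?_
    filter_upwards [lt_mem_nhds hw] with z hz using (hD1 z hz).deriv
  refine concaveOn_of_deriv2_nonpos' (convex_Icc _ _)
    (fun w hw => (hD1 w (hm.trans_le hw.1)).differentiableAt.differentiableWithinAt)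
    (fun w hw => (hD2 w (hm.trans_le hw.1)).differentiableAt.differentiableWithinAt) fun w hw => ?_
  rw [Function.iterate_succ, Function.iterate_one, Function.comp_apply,
    (hD2 w (hm.trans_le hw.1)).deriv]
  have := hL w hw
  rw [Real.norm_eq_abs] at this
  linarith [le_abs_self (p * ((p - 1) * w ^ (p - 1 - 1))), le_abs_self L]

theorem exists_lipschitz_rpow {m M : ℝ} (hm : 0 < m) (p : ℝ) :
    ∃ D : ℝ, 0 ≤ D ∧ ∀ w ∈ Set.Icc m M, ∀ z ∈ Set.Icc m M, |w ^ p - z ^ p| ≤ D * |w - z| := by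
  have hc : ContinuousOn (fun w : ℝ => p * w ^ (p - 1)) (Set.Icc m M) := by
    intro w hw
    have : w ≠ 0 := (hm.trans_le hw.1).ne'
    exact (continuousAt_const.mul
      (Real.continuousAt_rpow_const w _ (Or.inl this))).continuousWithinAt
  obtain ⟨D, hD⟩ := isCompact_Icc.exists_bound_of_continuousOn hc
  refine ⟨|D|, abs_nonneg D, fun w hw z hz => ?_⟩
  exact (convex_Icc m M).norm_image_sub_le_of_norm_hasDerivWithin_le
    (f := fun w : ℝ => w ^ p) (f' := fun w => p * w ^ (p - 1))
    (fun x hx => (Real.hasDerivAt_rpow_const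
      (Or.inl (hm.trans_le hx.1).ne')).hasDerivWithinAt)
    (fun x hx => (hD x hx).trans (le_abs_self D)) hz hw

/-- A positive power of a Lipschitz semi-concave function with values in a compact subset of the
positive half-line is semi-concave. -/
theorem exists_concaveOn_rpow_comp_sub_sq {I : Set ℝ} {u : ℝ → ℝ} {m M K Λ p : ℝ} (hm : 0 < m)
    (hp : 0 ≤ p) (hK : 0 ≤ K) (hI : ∀ x ∈ I, u x ∈ Set.Icc m M)
    (hΛ : ∀ x ∈ I, ∀ y ∈ I, |u x - u y| ≤ Λ * |x - y|)
    (hu : ConcaveOn ℝ I (fun x => u x - K / 2 * x ^ 2)) :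
    ∃ C : ℝ, ConcaveOn ℝ I (fun x => u x ^ p - C * x ^ 2) := by
  obtain ⟨L, hL0, hL⟩ := exists_concaveOn_rpow_sub_sq (M := M) hm p
  obtain ⟨D, hD0, hD⟩ := exists_lipschitz_rpow (M := M) hm p
  refine ⟨L / 2 * Λ ^ 2 + D * (K / 2), hu.1, fun x hx y hy s t hs ht hst => ?_⟩
  have hz := hu.1 hx hy hs ht hst
  have h1 := hu.2 hx hy hs ht hst
  have h2 := hL.2 (hI x hx) (hI y hy) hs ht hst
  have hw := convex_Icc m M (hI x hx) (hI y hy) hs ht hst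
  have hlip : (u x - u y) ^ 2 ≤ Λ ^ 2 * (x - y) ^ 2 := by
    rw [← sq_abs, ← sq_abs (x - y), ← mul_pow]
    exact pow_le_pow_left₀ (abs_nonneg _) (hΛ x hx y hy) 2
  simp only [smul_eq_mul] at h1 h2 hz hw ⊢
  have ident : ∀ c d : ℝ, s * c ^ 2 + t * d ^ 2 - (s * c + t * d) ^ 2 = s * t * (c - d) ^ 2 := by
    intro c d
    obtain rfl : t = 1 - s := by linarith
    ring
  have hst0 : 0 ≤ s * t := mul_nonneg hs ht
  have h1' : s * u x + t * u y - u (s * x + t * y) ≤ K / 2 * (s * t * (x - y) ^ 2) := by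
    rw [← ident]; linarith
  have h2' : s * u x ^ p + t * u y ^ p - (s * u x + t * u y) ^ p
      ≤ L / 2 * (s * t * (u x - u y) ^ 2) := by
    rw [← ident]; linarith
  have h2'' : L / 2 * (s * t * (u x - u y) ^ 2) ≤ L / 2 * (s * t * (Λ ^ 2 * (x - y) ^ 2)) := by
    gcongr
  have h3 : (s * u x + t * u y) ^ p - u (s * x + t * y) ^ p
      ≤ D * (K / 2 * (s * t * (x - y) ^ 2)) := by
    rcases le_total (s * u x + t * u y) (u (s * x + t * y)) with hle | hle
    · have := Real.rpow_le_rpow (hm.le.trans hw.1) hle hp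
      have : 0 ≤ D * (K / 2 * (s * t * (x - y) ^ 2)) := by positivity
      linarith
    · have := hD _ hw _ (hI _ hz)
      rw [abs_of_nonneg (sub_nonneg.2 hle)] at this
      exact (le_abs_self _).trans (this.trans (mul_le_mul_of_nonneg_left h1' hD0))
  have h4 := ident x y
  have h5 : (L / 2 * Λ ^ 2 + D * (K / 2)) * (s * x ^ 2 + t * y ^ 2 - (s * x + t * y) ^ 2)
      = L / 2 * (s * t * (Λ ^ 2 * (x - y) ^ 2)) + D * (K / 2 * (s * t * (x - y) ^ 2)) := by
    rw [h4]; ring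
  linarith

/-- let `h : [a,b] → [0,∞)` be continuous, positive on `(a,b)`, `N > 1`,
`η ∈ ℝ`, and suppose `(h^{1/(N−1)})'' + η·h^{1/(N−1)} ≤ 0` distributionally on `(a,b)`.
Then around every `r₀ ∈ (a,b)` there are a constant `C` and a neighbourhood on which
`r ↦ h(r) − C·r²` is concave (local semi-concavity). -/
theorem stmt4 (a b N η : ℝ) (hN : 1 < N) (h : ℝ → ℝ)
    (hcont : ContinuousOn h (Set.Icc a b))
    (hnonneg : ∀ x ∈ Set.Icc a b, 0 ≤ h x)
    (hpos : ∀ x ∈ Set.Ioo a b, 0 < h x)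
    (hdist : ∀ ψ : ℝ → ℝ, ContDiff ℝ (⊤ : ℕ∞) ψ → HasCompactSupport ψ →
      Function.support ψ ⊆ Set.Ioo a b → (∀ x, 0 ≤ ψ x) →
      (∫ x in Set.Ioo a b, (h x ^ ((1:ℝ)/(N-1))) * deriv (deriv ψ) x)
        + η * ∫ x in Set.Ioo a b, (h x ^ ((1:ℝ)/(N-1))) * ψ x ≤ 0) :
    ∀ r₀ ∈ Set.Ioo a b, ∃ C : ℝ, ∃ ε > 0,
      Set.Ioo (r₀ - ε) (r₀ + ε) ⊆ Set.Ioo a b ∧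
      ConcaveOn ℝ (Set.Ioo (r₀ - ε) (r₀ + ε)) (fun r => h r - C * r ^ 2) := by
  intro r₀ hr₀
  set u : ℝ → ℝ := fun x => h x ^ ((1:ℝ)/(N-1)) with hu
  have hN0 : 0 < N - 1 := sub_pos.2 hN
  have huc : ContinuousOn u (Set.Icc a b) :=
    hcont.rpow_const fun x _ => Or.inr (one_div_pos.2 hN0).le
  obtain ⟨M, hM⟩ := isCompact_Icc.exists_bound_of_continuousOn huc
  have hM0 : 0 ≤ M := (norm_nonneg _).trans (hM r₀ (Set.Ioo_subset_Icc_self hr₀))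
  have hupos : ∀ x ∈ Set.Ioo a b, 0 < u x := fun x hx => Real.rpow_pos_of_pos (hpos x hx) _
  have hconc := concaveOn_sub_sq_of_distributional (hr₀.1.trans hr₀.2).le huc hM hdist
  have huca : ContinuousAt u r₀ := huc.continuousAt (Icc_mem_nhds hr₀.1 hr₀.2)
  have hlip : LocallyLipschitzOn (Set.Ioo a b) u := by
    have h1 := hconc.locallyLipschitzOn isOpen_Ioo
    have h2 : ContDiff ℝ 1 (fun x : ℝ => |η| * M / 2 * x ^ 2) := by fun_prop
    simpa only [sub_add_cancel] using h1.add h2.locallyLipschitz.locallyLipschitzOn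
  obtain ⟨Λ, V, hV, hVl⟩ := hlip hr₀
  rw [isOpen_Ioo.nhdsWithin_eq hr₀] at hV
  have hnhds : V ∩ Set.Ioo a b ∩ {x | u r₀ / 2 < u x} ∈ 𝓝 r₀ :=
    Filter.inter_mem (Filter.inter_mem hV (isOpen_Ioo.mem_nhds hr₀))
      (huca.eventually_const_lt (half_lt_self (hupos r₀ hr₀)))
  obtain ⟨ε, hε, hsub⟩ := Metric.mem_nhds_iff.1 hnhds
  rw [Real.ball_eq_Ioo] at hsub
  have hIab : Set.Ioo (r₀ - ε) (r₀ + ε) ⊆ Set.Ioo a b := fun x hx => (hsub hx).1.2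
  obtain ⟨C, hC⟩ := exists_concaveOn_rpow_comp_sub_sq (I := Set.Ioo (r₀ - ε) (r₀ + ε))
    (u := u) (m := u r₀ / 2) (M := M) (K := |η| * M) (Λ := Λ) (p := N - 1)
    (half_pos (hupos r₀ hr₀)) hN0.le (by positivity)
    (fun x hx => ⟨(hsub hx).2.le,
      (le_abs_self _).trans (hM x (Set.Ioo_subset_Icc_self (hIab hx)))⟩)
    (fun x hx y hy => by
      simpa [Real.dist_eq] using hVl.dist_le_mul x (hsub hx).1.1 y (hsub hy).1.1)
    (hconc.subset hIab (convex_Ioo _ _))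
  refine ⟨C, ε, hε, hIab, hC.congr fun x hx => ?_⟩
  simp only [hu]
  rw [← Real.rpow_mul (hpos x (hIab hx)).le, one_div_mul_cancel hN0.ne', Real.rpow_one]
end
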